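/- arXiv:2212.01931 — 2 statements merged into one kernel-verified Lean document; each statement's English description precedes it below -/
import Mathlib

section
/- Let m be a positive integer, n = 3m, q = 2^n, and let δ ∈ F_q satisfy Tr_m^{3m}(δ) = 1. Define F : F_q → F_q by F(x) = (x^{2^m} + x + δ)^{2^{2m}+1} + x. Then for every c ∈ F_q not in the subfield F_{2^m} (i.e., c^{2^m} ≠ c), F is APcN: for all a, b ∈ F_q the equation F(x+a) + c·F(x) = b has at most two solutions x ∈ F_q, and there exist a, b ∈ F_q for which it has exactly two solutions. -/
section aux
variable {F : Type*} [Field F] [CharP F 2] (σ : F →+* F) (h3 : ∀ x, σ (σ (σ x)) = x)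
  (δ c : F) (hδ : δ + σ δ + σ (σ δ) = 1) (G : F → F)
  (hG : ∀ x, G x = (σ x + x + δ) * σ (σ (σ x + x + δ)) + x)

lemma aux_sq_inj {a b : F} (h : a ^ 2 = b ^ 2) : a = b := by
  have : (a + b) ^ 2 = 0 := by rw [CharTwo.add_sq, h]; exact CharTwo.add_self_eq_zero _
  exact CharTwo.add_eq_zero.1 (pow_eq_zero_iff (two_ne_zero) |>.1 this)

lemma aux_tr (h3 : ∀ x, σ (σ (σ x)) = x) (hδ : δ + σ δ + σ (σ δ) = 1) (x : F) :
    σ (σ (σ x + x + δ)) = 1 + (σ x + x + δ) + σ (σ x + x + δ) := by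
  have h2 : (2 : F) = 0 := CharTwo.two_eq_zero
  simp only [map_add, h3]
  linear_combination hδ - (δ + σ δ + σ x) * h2

lemma aux_G (h3 : ∀ x, σ (σ (σ x)) = x) (hδ : δ + σ δ + σ (σ δ) = 1)
    (hG : ∀ x, G x = (σ x + x + δ) * σ (σ (σ x + x + δ)) + x) (x : F) :
    (σ x + x + δ) ^ 2 = σ (G x) + G x + δ := by
  have h2 : (2 : F) = 0 := CharTwo.two_eq_zero
  have ht := aux_tr σ δ h3 hδ x
  have hx : σ (G x) = σ (σ x + x + δ) * (σ x + x + δ) + σ x := by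
    rw [hG x, map_add, map_mul, h3]
  rw [hx, hG x, ht]
  generalize hv : σ (σ x + x + δ) = v
  linear_combination -((σ x + x + δ) + v * (σ x + x + δ)) * h2

lemma aux_inj (h3 : ∀ x, σ (σ (σ x)) = x) (hδ : δ + σ δ + σ (σ δ) = 1)
    (hG : ∀ x, G x = (σ x + x + δ) * σ (σ (σ x + x + δ)) + x) {x y : F} (h : G x = G y) :
    x = y := by
  have hu : σ x + x + δ = σ y + y + δ := by
    apply aux_sq_inj
    rw [aux_G σ δ G h3 hδ hG, aux_G σ δ G h3 hδ hG, h]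
  rw [hG x, hG y, hu] at h
  exact add_left_cancel h

lemma aux_shift (hG : ∀ x, G x = (σ x + x + δ) * σ (σ (σ x + x + δ)) + x) (x a : F) :
    G (x + a) = G x + a + (σ x + x + δ) * σ (σ (σ a + a)) + (σ a + a) * σ (σ (σ x + x + δ))
      + (σ a + a) * σ (σ (σ a + a)) := by
  rw [hG (x + a), hG x]
  simp only [map_add]
  ring

lemma aux_main (h3 : ∀ x, σ (σ (σ x)) = x) (hδ : δ + σ δ + σ (σ δ) = 1)
    (hG : ∀ x, G x = (σ x + x + δ) * σ (σ (σ x + x + δ)) + x)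
    (hs : ∀ x : F, ∃ y, y ^ 2 = x)
    (l : F) (hl : (1 + c) * l ^ 2 = 1) (a b x₁ x₂ : F)
    (e₁ : G (x₁ + a) + c * G x₁ = b) (e₂ : G (x₂ + a) + c * G x₂ = b) (hne : x₁ ≠ x₂) :
    (1 + c) * (G x₁ + G x₂) =
      ((σ l + l) * σ (σ (σ a + a)) + (σ a + a) * σ (σ (σ l + l))) ^ 2 := by
  have h2 : (2 : F) = 0 := CharTwo.two_eq_zero
  have hc1 : 1 + c ≠ 0 := left_ne_zero_of_mul (by rw [hl]; exact one_ne_zero)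
  have key : ∀ x, G (x + a) + c * G x = b →
      σ ((1 + c) * G x) + (1 + c) * G x = (σ a + a) ^ 2 + σ b + b := by
    intro x e
    have g0 := aux_G σ δ G h3 hδ hG x
    have ga := aux_G σ δ G h3 hδ hG (x + a)
    have hz : G (x + a) = b + c * G x := by linear_combination e - c * G x * h2
    rw [hz] at ga
    simp only [map_add, map_mul, map_one] at ga g0 ⊢
    linear_combination ga - g0 +
      (σ c * σ (G x) + c * G x - (σ a + a) ^ 2 - (σ x + x + δ) * (σ a + a)) * h2
  obtain ⟨s, hs⟩ := hs ((1 + c) * (G x₁ + G x₂))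
  have hsf : σ s = s := by
    apply aux_sq_inj
    rw [← map_pow, hs]
    have k1 := key x₁ e₁
    have k2 := key x₂ e₂
    simp only [map_add, map_mul, map_one] at k1 k2 ⊢
    linear_combination k1 - k2 + ((1 + σ c) * σ (G x₂) - (1 + c) * G x₁) * h2
  have hy : G x₁ + G x₂ = s ^ 2 * l ^ 2 := by
    linear_combination (-l ^ 2) * hs - (G x₁ + G x₂) * hl + 0 * h2
  have hu : (σ x₁ + x₁ + δ) + (σ x₂ + x₂ + δ) = s * (σ l + l) := by
    apply aux_sq_inj
    have hy' := congrArg σ hy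
    simp only [map_add, map_mul, map_pow, hsf] at hy'
    rw [CharTwo.add_sq, aux_G σ δ G h3 hδ hG, aux_G σ δ G h3 hδ hG]
    linear_combination hy + hy' + (δ - s ^ 2 * σ l * l) * h2
  have hu' := congrArg σ (congrArg σ hu)
  rw [map_add, map_add, map_mul, map_mul, hsf, hsf] at hu'
  rw [aux_shift σ δ G hG] at e₁ e₂
  have hq : s * (s + ((σ l + l) * σ (σ (σ a + a)) + (σ a + a) * σ (σ (σ l + l)))) = 0 := by
    generalize σ (σ (σ a + a)) = p at *
    generalize σ (σ (σ l + l)) = r at *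
    generalize σ (σ (σ x₁ + x₁ + δ)) = v₁ at *
    generalize σ (σ (σ x₂ + x₂ + δ)) = v₂ at *
    generalize σ x₁ + x₁ + δ = u₁ at *
    generalize σ x₂ + x₂ + δ = u₂ at *
    linear_combination e₁ - e₂ + hs - p * hu - (σ a + a) * hu' +
      ((1 + c) * G x₂ + p * u₂ + (σ a + a) * v₂) * h2
  rcases mul_eq_zero.1 hq with h | h
  · exfalso
    rw [h, zero_pow two_ne_zero] at hs
    exact hne (aux_inj σ δ G h3 hδ hG
      (CharTwo.add_eq_zero.1 ((mul_eq_zero.1 hs.symm).resolve_left hc1)))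
  · rw [← hs, CharTwo.add_eq_zero.1 h]

lemma aux_exists (h3 : ∀ x, σ (σ (σ x)) = x) (hδ : δ + σ δ + σ (σ δ) = 1)
    (hG : ∀ x, G x = (σ x + x + δ) * σ (σ (σ x + x + δ)) + x)
    (l : F) (hl : (1 + c) * l ^ 2 = 1) (hc : σ c ≠ c) :
    ∃ a x₁ x₂ : F, x₁ ≠ x₂ ∧ G (x₁ + a) + c * G x₁ = G (x₂ + a) + c * G x₂ := by
  have h2 : (2 : F) = 0 := CharTwo.two_eq_zero
  have hl0 : l ≠ 0 := by rintro rfl; simp at hl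
  have hk : σ l + l ≠ 0 := by
    intro h
    have h := CharTwo.add_eq_zero.1 h
    apply hc
    have hl' := congrArg σ hl
    simp only [map_add, map_mul, map_pow, map_one, h] at hl'
    have : (1 + σ c) = 1 + c := mul_right_cancel₀ (pow_ne_zero 2 hl0) (hl'.trans hl.symm)
    exact add_left_cancel this
  have hk' : σ (σ l + l) ≠ 0 := (map_ne_zero σ).2 hk
  obtain ⟨a, ha⟩ : ∃ a, a * σ (σ l + l) = δ := ⟨δ / σ (σ l + l), div_mul_cancel₀ _ hk'⟩
  have ha1 := congrArg σ ha
  have ha2 := congrArg σ ha1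
  have hβ : (σ l + l) * σ (σ (σ a + a)) + (σ a + a) * σ (σ (σ l + l)) = 1 := by
    rw [← ha2, ← ha1, ← ha] at hδ
    simp only [map_add, map_mul, h3] at hδ ⊢
    linear_combination hδ +
      (a * l) * h2
  -- second solution
  have ht := aux_tr σ δ h3 hδ 0
  have g0 := aux_G σ δ G h3 hδ hG 0
  obtain ⟨u, hu⟩ : ∃ u, u = (σ 0 + 0 + δ) + (σ l + l) := ⟨_, rfl⟩
  obtain ⟨y, hy⟩ : ∃ y, y = G 0 + l ^ 2 := ⟨_, rfl⟩
  have hu2 : u ^ 2 = σ y + y + δ := by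
    rw [hu, hy, CharTwo.add_sq, g0]
    simp only [map_add, map_pow]
    linear_combination (σ l * l) * h2
  have hut : σ (σ u) = 1 + u + σ u := by
    rw [hu, map_add, map_add, ht]
    simp only [map_add, h3]
    linear_combination (-σ l) * h2
  have hX : σ (y + u * σ (σ u)) + (y + u * σ (σ u)) + δ = u := by
    rw [map_add, map_mul, h3, hut]
    linear_combination (-1) * hu2 + (u ^ 2 + σ u * u) * h2
  have hGX : G (y + u * σ (σ u)) = y := by
    rw [hG, hX]
    linear_combination (u * σ (σ u)) * h2
  refine ⟨a, 0, y + u * σ (σ u), ?_, ?_⟩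
  · intro h
    rw [← h, hy] at hGX
    exact hl0 (pow_eq_zero_iff two_ne_zero |>.1 (left_eq_add.1 hGX))
  · rw [aux_shift σ δ G hG, aux_shift σ δ G hG, hX, hGX, hy]
    have hu' : σ (σ u) = σ (σ (σ 0 + 0 + δ)) + σ (σ (σ l + l)) := by rw [hu, map_add, map_add]
    rw [hu', hu]
    linear_combination (-1) * hl - hβ - 1 * h2

end aux

theorem stmt_6 (m : ℕ) (hm : 0 < m) (F : Type*) [Field F] [Fintype F]
    (hF : Fintype.card F = 2 ^ (3 * m)) (δ c : F)
    (hδ : δ + δ ^ (2 ^ m) + δ ^ (2 ^ (2 * m)) = 1)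
    (hc : c ^ (2 ^ m) ≠ c)
    (G : F → F) (hG : ∀ x, G x = (x ^ (2 ^ m) + x + δ) ^ (2 ^ (2 * m) + 1) + x) :
    (∀ a b : F, {x : F | G (x + a) + c * G x = b}.ncard ≤ 2) ∧
    (∃ a b : F, {x : F | G (x + a) + c * G x = b}.ncard = 2) := by
  haveI : Fact (Nat.Prime 2) := ⟨Nat.prime_two⟩
  haveI : CharP F 2 := charP_of_card_eq_prime_pow hF
  let σ : F →+* F := iterateFrobenius F 2 m
  have hσ : ∀ x, σ x = x ^ 2 ^ m := fun x => iterateFrobenius_def 2 m x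
  have hσ2 : ∀ x, σ (σ x) = x ^ 2 ^ (2 * m) := fun x => by
    rw [hσ, hσ, ← pow_mul, ← pow_add, two_mul]
  have h3 : ∀ x, σ (σ (σ x)) = x := fun x => by
    rw [hσ2, hσ, ← pow_mul, ← pow_add]
    have := FiniteField.pow_card x
    rw [hF] at this
    rw [show m + 2 * m = 3 * m by ring, this]
  have hδ' : δ + σ δ + σ (σ δ) = 1 := by rw [hσ2, hσ]; exact hδ
  have hG' : ∀ x, G x = (σ x + x + δ) * σ (σ (σ x + x + δ)) + x := fun x => by
    rw [hσ2, hσ, hG, pow_succ, mul_comm]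
  have hc' : σ c ≠ c := by rw [hσ]; exact hc
  have hs : ∀ x : F, ∃ y, y ^ 2 = x := by
    intro x
    have hinj : Function.Injective (fun y : F => y ^ 2) := fun a b h => aux_sq_inj h
    exact (Finite.injective_iff_surjective.1 hinj) x
  have hc1 : 1 + c ≠ 0 := by
    intro h
    have := CharTwo.add_eq_zero.1 h
    apply hc'
    rw [← this, map_one]
  obtain ⟨l, hl⟩ := hs (1 + c)⁻¹
  have hl : (1 + c) * l ^ 2 = 1 := by rw [hl, mul_inv_cancel₀ hc1]
  have hle : ∀ a b : F, {x : F | G (x + a) + c * G x = b}.ncard ≤ 2 := by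
    intro a b
    by_contra hcon
    obtain ⟨x, y, z, hx, hy, hz, hxy, hxz, hyz⟩ :=
      (Set.two_lt_ncard_iff (Set.toFinite _)).1 (not_le.1 hcon)
    have k1 := aux_main σ δ c G h3 hδ' hG' hs l hl a b x y hx hy hxy
    have k2 := aux_main σ δ c G h3 hδ' hG' hs l hl a b x z hx hz hxz
    have := mul_left_cancel₀ hc1 (k1.trans k2.symm)
    exact hyz (aux_inj σ δ G h3 hδ' hG' (add_left_cancel this))
  refine ⟨hle, ?_⟩
  obtain ⟨a, x₁, x₂, hne, he⟩ := aux_exists σ δ c G h3 hδ' hG' l hl hc'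
  refine ⟨a, G (x₁ + a) + c * G x₁, le_antisymm (hle _ _) ?_⟩
  rw [← Set.ncard_pair hne]
  apply Set.ncard_le_ncard _ (Set.toFinite _)
  rintro x (rfl | rfl)
  · rfl
  · exact he.symm
end

section
/- Let m be a positive integer with m ≢ 1 (mod 3), n = 3m, q = 2^n, and let δ ∈ F_q satisfy Tr_m^{3m}(δ) = 0. Define F : F_q → F_q by F(x) = (x^{2^m} + x + δ)^{2^{2m−1} + 2^{m−1}} + x. Then for every c ∈ F_q not in the subfield F_{2^m} (i.e., c^{2^m} ≠ c), F is APcN: for all a, b ∈ F_q the equation F(x+a) + c·F(x) = b has at most two solutions x ∈ F_q, and there exist a, b ∈ F_q for which it has exactly two solutions. -/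
theorem aux_sq {F : Type*} [Field F] (h2 : (2 : F) = 0) {u v : F} (h : u ^ 2 = v ^ 2) : u = v := by
  have h3 : (u - v) ^ 2 = 0 := by linear_combination h + (v ^ 2 - u * v) * h2
  exact sub_eq_zero.mp (pow_eq_zero_iff (two_ne_zero)|>.mp h3)

theorem aux_main_s9 {F : Type*} [Field F] [Fintype F] (h2 : (2 : F) = 0) (σ : F →+* F)
    (h3 : ∀ x, σ (σ (σ x)) = x) (δ c : F) (hδ : δ + σ δ + σ (σ δ) = 0) (hc : σ c ≠ c)
    (G : F → F) (hG : ∀ x, (G x + x) ^ 2 = σ (σ x + x + δ) * σ (σ (σ x + x + δ))) :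
    (∀ a b : F, {x : F | G (x + a) + c * G x = b}.ncard ≤ 2) ∧
    (∃ a b : F, {x : F | G (x + a) + c * G x = b}.ncard = 2) := by
  have h1 : ∀ x, G x + σ (G x) = σ (σ x) + σ x + σ δ + δ := by
    intro x
    have e : (G x + x + σ (G x + x)) ^ 2 = (σ (σ (σ x + x + δ))) ^ 2 := by
      have e1 := hG x
      have e2 := congrArg σ e1
      simp only [map_pow, map_mul, map_add, h3] at e1 e2 ⊢
      grind
    have e' := aux_sq h2 e
    simp only [map_add, h3] at e'
    grind
  have hinj : Function.Injective G := by
    intro x y hxy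
    have e1 := h1 x
    have e2 := h1 y
    rw [hxy, e2] at e1
    have e3 := congrArg σ e1
    have e4 := congrArg σ e3
    simp only [map_add, h3] at e3 e4
    have e5 := hG x
    have e6 := hG y
    have e7 : (G x + x) ^ 2 = (G y + y) ^ 2 := by
      rw [e5, e6]
      simp only [map_add, h3]
      congr 1
      · grind
      · grind
    have e8 := aux_sq h2 e7
    rw [hxy] at e8
    exact add_left_cancel e8
  have hsurj : Function.Surjective G := Finite.surjective_of_injective hinj
  have hc1 : 1 + c ≠ 0 := by
    intro h
    apply hc
    have : c = 1 := by linear_combination h - h2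
    rw [this, map_one]
  obtain ⟨g, hg⟩ : ∃ g, g = (1 + c)⁻¹ := ⟨_, rfl⟩
  have hgc : (1 + c) * g = 1 := by rw [hg]; exact mul_inv_cancel₀ hc1
  have hgs : σ g ≠ g := by
    intro h
    apply hc
    have e := congrArg σ hgc
    simp only [map_mul, map_add, map_one, h] at e
    have hg0 : g ≠ 0 := by rintro rfl; simp at hgc
    apply mul_right_cancel₀ hg0
    linear_combination e - hgc
  -- difference identities
  let D : F → F → F := fun a x => G (x + a) + G x
  let K : F → F := fun a => (g + σ g) * (a + σ (σ a)) + (σ (σ a) + σ a) * (σ g + σ (σ g))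
  have hD : ∀ a x, D a x + σ (D a x) = σ (σ a) + σ a := by
    intro a x
    have e1 := h1 (x + a)
    have e2 := h1 x
    simp only [D, map_add] at *
    grind
  have hDD : ∀ a x x', (D a x + D a x') ^ 2 =
      (G x + G x' + σ (G x + G x')) * (a + σ (σ a)) +
        (σ (σ a) + σ a) * σ (G x + G x' + σ (G x + G x')) := by
    intro a x x'
    have e1 := h1 x
    have e2 := h1 x'
    have e : G x + G x' + σ (G x + G x') = σ (σ x) + σ x + σ (σ x') + σ x' := by
      simp only [map_add]; grind
    rw [e]
    have f1 := hG x
    have f2 := hG x'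
    have f3 := hG (x + a)
    have f4 := hG (x' + a)
    simp only [D, map_add, h3] at *
    clear e e1 e2 hgs hc hD K hinj hsurj h1 hG
    grind
  have key : ∀ a b x x', G (x + a) + c * G x = b → G (x' + a) + c * G x' = b → x' ≠ x →
      G x' = G x + K a * g := by
    intro a b x x' hx hx' hne
    obtain ⟨s, hs⟩ : ∃ s, s = D a x + D a x' := ⟨_, rfl⟩
    have hσs : σ s = s := by
      have e1 := hD a x
      have e2 := hD a x'
      rw [hs, map_add]
      grind
    have e0 : (1 + c) * (G x + G x') = s := by
      rw [hs]; simp only [D]; grind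
    have e1 : G x + G x' = s * g := by
      linear_combination g * e0 - (G x + G x') * hgc
    have e2 := hDD a x x'
    rw [e1, ← hs] at e2
    simp only [map_mul, map_add, hσs] at e2
    have e3 : s * (s - K a) = 0 := by
      simp only [K]; linear_combination e2
    rcases mul_eq_zero.mp e3 with h | h
    · exfalso
      apply hne
      apply hinj
      rw [h] at e1
      linear_combination e1 - G x * h2
    · have : s = K a := by linear_combination h
      rw [← this]
      linear_combination e1 - G x * h2
  have hK : ∀ a, σ (K a) = K a := by
    intro a
    simp only [K, map_add, map_mul, h3]
    grind
  have upper : ∀ a b : F, {x : F | G (x + a) + c * G x = b}.ncard ≤ 2 := by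
    intro a b
    rcases Set.eq_empty_or_nonempty {x : F | G (x + a) + c * G x = b} with h | ⟨x, hx⟩
    · rw [h]; simp
    · obtain ⟨z, hz⟩ := hsurj (G x + K a * g)
      refine (Set.ncard_le_ncard (t := {x, z}) ?_ (Set.toFinite _)).trans ((Set.ncard_insert_le x {z}).trans (by simp))
      intro w hw
      by_cases hwx : w = x
      · simp [hwx]
      · right
        apply hinj
        rw [hz]
        exact key a b x w hx hw hwx
  refine ⟨upper, ?_⟩
  have hex : ∃ a, K a ≠ 0 := by
    by_contra! hno
    have e1 := hno g
    have e2 := hno (g ^ 2)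
    simp only [K, map_pow] at e1 e2
    obtain ⟨p, hp⟩ : ∃ p, p = g + σ g := ⟨_, rfl⟩
    obtain ⟨r, hr⟩ : ∃ r, r = σ g + σ (σ g) := ⟨_, rfl⟩
    have f1 : p ^ 2 + p * r + r ^ 2 = 0 := by grind
    have f2 : p * (p ^ 2 + r ^ 2) + r ^ 3 = 0 := by grind
    have f3 : p ^ 3 - r ^ 3 = 0 := by linear_combination (p - r) * f1
    have f4 : p * r ^ 2 = 0 := by linear_combination f2 - f3 - r ^ 3 * h2
    have f5 : p = 0 := by
      rcases mul_eq_zero.mp f4 with h | h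
      · exact h
      · have : r = 0 := by simpa using h
        rw [this] at f1
        simpa using f1
    apply hgs
    linear_combination f5 - hp - g * h2
  obtain ⟨a, ha⟩ := hex
  refine ⟨a, G (0 + a) + c * G 0, ?_⟩
  obtain ⟨z, hz⟩ := hsurj (G 0 + K a * g)
  apply le_antisymm (upper _ _)
  have hg0 : g ≠ 0 := by rintro rfl; simp at hgc
  have hz0 : (0 : F) ≠ z := by
    rintro rfl
    have : K a * g = 0 := by linear_combination -hz
    exact mul_ne_zero ha hg0 this
  rw [← Set.ncard_pair hz0]
  apply Set.ncard_le_ncard _ (Set.toFinite _)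
  rintro w (rfl | rfl)
  · rfl
  · show G (w + a) + c * G w = _
    have e1 : G 0 + G w = K a * g := by linear_combination hz + G 0 * h2
    have e2 := hDD a 0 w
    rw [e1] at e2
    simp only [map_add, map_mul, hK] at e2
    have e3 : (D a 0 + D a w) ^ 2 = (K a) ^ 2 := by
      rw [e2]; simp only [K]; ring
    have e4 := aux_sq h2 e3
    simp only [D] at e4
    generalize K a = k at *
    grind

theorem stmt_9 (m : ℕ) (hm : 0 < m) (hm3 : m % 3 ≠ 1) (F : Type*) [Field F] [Fintype F]
    (hF : Fintype.card F = 2 ^ (3 * m)) (δ c : F)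
    (hδ : δ + δ ^ (2 ^ m) + δ ^ (2 ^ (2 * m)) = 0)
    (hc : c ^ (2 ^ m) ≠ c)
    (G : F → F)
    (hG : ∀ x, G x = (x ^ (2 ^ m) + x + δ) ^ (2 ^ (2 * m - 1) + 2 ^ (m - 1)) + x) :
    (∀ a b : F, {x : F | G (x + a) + c * G x = b}.ncard ≤ 2) ∧
    (∃ a b : F, {x : F | G (x + a) + c * G x = b}.ncard = 2) := by
  have h2 : (2 : F) = 0 := by
    have h := FiniteField.cast_card_eq_zero F
    rw [hF] at h
    push_cast at h
    exact pow_eq_zero_iff (by omega) |>.mp h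
  have : CharP F 2 := CharTwo.of_one_ne_zero_of_two_eq_zero one_ne_zero h2
  have hσ : ∀ x : F, iterateFrobenius F 2 m x = x ^ (2 ^ m) := fun x => iterateFrobenius_def 2 m x
  have hσ2 : ∀ x : F, iterateFrobenius F 2 m (iterateFrobenius F 2 m x) = x ^ (2 ^ (2 * m)) := by
    intro x
    rw [hσ, hσ, ← pow_mul, ← pow_add, two_mul]
  refine aux_main_s9 h2 (iterateFrobenius F 2 m) ?_ δ c ?_ ?_ G ?_
  · intro x
    rw [hσ2, hσ, ← pow_mul, ← pow_add, show m + 2 * m = 3 * m by ring, ← hF]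
    exact FiniteField.pow_card x
  · rw [hσ2, hσ]; exact hδ
  · rw [hσ]; exact hc
  · intro x
    rw [hσ2, hσ, hσ, hG]
    generalize x ^ (2 ^ m) + x + δ = y
    have e : y ^ (2 ^ (2 * m - 1) + 2 ^ (m - 1)) + x + x
        = y ^ (2 ^ (2 * m - 1) + 2 ^ (m - 1)) := by linear_combination x * h2
    rw [e, ← pow_mul, ← pow_add]
    congr 1
    rw [add_mul, ← pow_succ, ← pow_succ, show 2 * m - 1 + 1 = 2 * m by omega,
      show m - 1 + 1 = m by omega, add_comm]
end
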